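/- Let m ≥ 1, let f : ℝ^m → ℝ^m be four times continuously differentiable, and let u : ℝ → ℝ^m solve u' = f(u) on a neighborhood of a point t. For h > 0 set v¹ = f(u(t)), v²(h) = ( f(u(t)+h·v¹) − f(u(t)−h·v¹) )/(2h), and v³(h) = ( f(u(t)+h·v¹+(h²/2)·v²(h)) − 2·f(u(t)) + f(u(t)−h·v¹+(h²/2)·v²(h)) )/h². Then there exist constants C > 0 and h₀ > 0 such that for all 0 < h < h₀, ‖ u(t+h) − [ u(t) + h·v¹ + (h²/2)·v²(h) + (h³/6)·v³(h) ] ‖ ≤ C·h⁴. -/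

import Mathlib

open Asymptotics Filter Topology

section helpers

variable {E F : Type*} [NormedAddCommGroup E] [NormedSpace ℝ E]
  [NormedAddCommGroup F] [NormedSpace ℝ F]

/-- Integrating a big-O estimate of the derivative. -/
lemma integrate_bigO (g : E → F) (g' : E → E →L[ℝ] F) (n : ℕ) (h0 : g 0 = 0)
    (hg : ∀ᶠ y in 𝓝 (0 : E), HasFDerivAt g (g' y) y)
    (hb : g' =O[𝓝 0] (fun y => ‖y‖ ^ n)) :
    g =O[𝓝 0] (fun y => ‖y‖ ^ (n + 1)) := by
  obtain ⟨C, hC, hb⟩ := hb.exists_nonneg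
  obtain ⟨r, hr, hball⟩ := Metric.eventually_nhds_iff_ball.1 (hg.and hb.bound)
  refine IsBigO.of_bound C ?_
  filter_upwards [Metric.ball_mem_nhds (0 : E) hr] with y hy
  rw [mem_ball_zero_iff] at hy
  have hsub : ∀ z ∈ Metric.closedBall (0 : E) ‖y‖, z ∈ Metric.ball (0 : E) r := by
    intro z hz
    rw [mem_closedBall_zero_iff] at hz
    rw [mem_ball_zero_iff]
    exact hz.trans_lt hy
  have key := Convex.norm_image_sub_le_of_norm_hasFDerivWithin_le (𝕜 := ℝ) (f := g) (f' := g')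
    (s := Metric.closedBall (0 : E) ‖y‖) (C := C * ‖y‖ ^ n) (x := 0) (y := y)
    (fun z hz => (hball z (hsub z hz)).1.hasFDerivWithinAt)
    (fun z hz => by
      have h1 := (hball z (hsub z hz)).2
      rw [mem_closedBall_zero_iff] at hz
      rw [norm_pow, norm_norm] at h1
      exact h1.trans (by gcongr))
    (convex_closedBall _ _) (by simp) (by simp)
  rw [h0, sub_zero, sub_zero] at key
  rw [norm_pow, norm_norm, pow_succ, ← mul_assoc]
  exact key

lemma integrate_bigO_real (g : ℝ → F) (g' : ℝ → F) (n : ℕ) (h0 : g 0 = 0)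
    (hg : ∀ᶠ y in 𝓝 (0 : ℝ), HasDerivAt g (g' y) y)
    (hb : g' =O[𝓝 0] (fun y : ℝ => y ^ n)) :
    g =O[𝓝 0] (fun y : ℝ => y ^ (n + 1)) := by
  have := integrate_bigO g (fun y => ContinuousLinearMap.toSpanSingleton ℝ (g' y)) n h0
    (hg.mono fun y hy => hy.hasFDerivAt) (by
      have h1 : (fun y => ContinuousLinearMap.toSpanSingleton ℝ (g' y)) =O[𝓝 (0:ℝ)] g' :=
        IsBigO.of_bound 1 (Eventually.of_forall fun y => by simp)
      refine (h1.trans hb).trans (IsBigO.of_bound 1 (Eventually.of_forall fun y => by simp)))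
  exact this.trans (IsBigO.of_bound 1 (Eventually.of_forall fun y => by simp))

lemma pow_bigO_pow {a b : ℕ} (h : a ≤ b) : (fun y : ℝ => y ^ b) =O[𝓝 0] (fun y : ℝ => y ^ a) := by
  refine IsBigO.of_bound 1 ?_
  filter_upwards [Metric.ball_mem_nhds (0 : ℝ) one_pos] with y hy
  rw [mem_ball_zero_iff] at hy
  rw [norm_pow, norm_pow, one_mul]
  exact pow_le_pow_of_le_one (norm_nonneg _) hy.le h

lemma bilin_bigO (B : E →L[ℝ] E →L[ℝ] F) {p q : ℝ → E} {a b : ℕ}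
    (hp : p =O[𝓝 0] (fun y : ℝ => y ^ a)) (hq : q =O[𝓝 0] (fun y : ℝ => y ^ b)) :
    (fun h => B (p h) (q h)) =O[𝓝 0] (fun y : ℝ => y ^ (a + b)) := by
  have h1 : (fun h => B (p h) (q h)) =O[𝓝 0] (fun h => ‖p h‖ * ‖q h‖) :=
    IsBigO.of_bound ‖B‖ (Eventually.of_forall fun y => by
      have := B.le_opNorm₂ (p y) (q y)
      rw [norm_mul, norm_norm, norm_norm, ← mul_assoc]
      exact this)
  refine h1.trans ?_
  simp only [pow_add]
  exact hp.norm_left.mul hq.norm_left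

lemma lin_bigO (A : E →L[ℝ] F) {p : ℝ → E} {a : ℕ}
    (hp : p =O[𝓝 0] (fun y : ℝ => y ^ a)) :
    (fun h => A (p h)) =O[𝓝 0] (fun y : ℝ => y ^ a) :=
  (A.isBigO_comp p _).trans hp

lemma smul_bigO (c : ℝ) {p : ℝ → E} {a : ℕ} (k : ℕ)
    (hp : p =O[𝓝 0] (fun y : ℝ => y ^ a)) :
    (fun h => (c * h ^ k) • p h) =O[𝓝 0] (fun y : ℝ => y ^ (k + a)) := by
  simp only [pow_add]
  have h1 : (fun h : ℝ => c * h ^ k) =O[𝓝 0] (fun h : ℝ => h ^ k) :=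
    (isBigO_refl _ _).const_mul_left c
  exact h1.smul hp

lemma const_bigO (v : E) : (fun _ : ℝ => v) =O[𝓝 0] (fun y : ℝ => y ^ 0) := by
  simpa using isBigO_const_const v (one_ne_zero (α := ℝ)) (𝓝 (0 : ℝ))

lemma rem_bigO {R : E → F} (hR : R =O[𝓝 0] (fun y => ‖y‖ ^ 3)) {p : ℝ → E}
    (hp : p =O[𝓝 0] (fun y : ℝ => y ^ 1)) :
    (fun h => R (p h)) =O[𝓝 0] (fun y : ℝ => y ^ 3) := by
  have ht : Tendsto p (𝓝 0) (𝓝 0) := by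
    refine hp.trans_tendsto ?_
    simpa using (continuous_id'.tendsto (0 : ℝ))
  refine (hR.comp_tendsto ht).trans ?_
  have := hp.norm_left.pow 3
  simpa [Function.comp_def] using this

lemma diff_bigO (g : E → F) (x : E) (hg : DifferentiableAt ℝ g x) :
    (fun y => g (x + y) - g x) =O[𝓝 0] (fun y : E => ‖y‖ ^ 1) := by
  have h1 := hg.isBigO_sub
  have ht : Tendsto (fun y : E => x + y) (𝓝 0) (𝓝 x) := by
    have : Continuous fun y : E => x + y := by fun_prop
    simpa using this.tendsto 0
  have h2 := (h1.comp_tendsto ht).norm_right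
  simpa [Function.comp_def] using h2

/-- Second order Taylor expansion with cubic remainder. -/
lemma taylor_two (f : E → F) (hf : ContDiff ℝ 4 f) (x : E) :
    ∃ (A : E →L[ℝ] F) (B : E →L[ℝ] E →L[ℝ] F) (R : E → F),
      (R =O[𝓝 0] (fun y => ‖y‖ ^ 3)) ∧
      ∀ y, f (x + y) = f x + A y + (1 / 2 : ℝ) • B y y + R y := by
  have hf1 : ContDiff ℝ 3 (fderiv ℝ f) := hf.fderiv_right (by norm_num)
  have hf2 : ContDiff ℝ 2 (fderiv ℝ (fderiv ℝ f)) := hf1.fderiv_right (by norm_num)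
  set A := fderiv ℝ f x with hA
  set B := fderiv ℝ (fderiv ℝ f) x with hB
  have hsymm : ∀ v w, B v w = B w v := by
    have : IsSymmSndFDerivAt ℝ f x := hf.contDiffAt.isSymmSndFDerivAt (by simp; norm_num)
    exact fun v w => this v w
  have hshift : ∀ y : E, HasFDerivAt (fun y : E => x + y) (ContinuousLinearMap.id ℝ E) y :=
    fun y => (hasFDerivAt_id y).const_add x
  have hb0 : (fun y => fderiv ℝ (fderiv ℝ f) (x + y) - B) =O[𝓝 0] (fun y : E => ‖y‖ ^ 1) := by
    exact diff_bigO _ x ((hf2.differentiable (by norm_num)) x)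
  have hb1 : (fun y => fderiv ℝ f (x + y) - A - B y) =O[𝓝 0] (fun y : E => ‖y‖ ^ 2) := by
    refine integrate_bigO _ (fun y => fderiv ℝ (fderiv ℝ f) (x + y) - B) 1 (by simp [hA])
      (Eventually.of_forall fun y => ?_) hb0
    have h1 : HasFDerivAt (fderiv ℝ f) (fderiv ℝ (fderiv ℝ f) (x + y)) (x + y) :=
      ((hf1.differentiable (by norm_num)) (x + y)).hasFDerivAt
    have h2 := h1.comp y (hshift y)
    exact ((h2.sub_const A).sub B.hasFDerivAt)
  refine ⟨A, B, fun y => f (x + y) - f x - A y - (1 / 2 : ℝ) • B y y, ?_, fun y => by module⟩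
  refine integrate_bigO _ (fun y => fderiv ℝ f (x + y) - A - B y) 2 (by simp)
      (Eventually.of_forall fun y => ?_) hb1
  have h1 : HasFDerivAt f (fderiv ℝ f (x + y)) (x + y) :=
    ((hf.differentiable (by norm_num)) (x + y)).hasFDerivAt
  have h2 := h1.comp y (hshift y)
  have h3 : HasFDerivAt (fun y => B y y) _ y := B.hasFDerivAt.clm_apply (hasFDerivAt_id y)
  have h4 := ((h2.sub_const (f x)).sub A.hasFDerivAt).sub (h3.const_smul (1 / 2 : ℝ))
  refine h4.congr_fderiv ?_
  ext z
  simp [hsymm z y]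
  module

/-- Third order expansion of the exact solution. -/
lemma exact_expansion (f : E → E) (x : E) (A : E →L[ℝ] E) (B : E →L[ℝ] E →L[ℝ] E) (R : E → E)
    (hR : R =O[𝓝 0] (fun y => ‖y‖ ^ 3))
    (hf : ∀ y, f (x + y) = f x + A y + (1 / 2 : ℝ) • B y y + R y)
    (hfc : Continuous f)
    (d : ℝ → E) (hd0 : d 0 = 0) (hd : ∀ᶠ h in 𝓝 (0 : ℝ), HasDerivAt d (f (x + d h)) h) :
    (fun h => d h - h • f x - (h ^ 2 / 2) • A (f x)
      - (h ^ 3 / 6) • (B (f x) (f x) + A (A (f x)))) =O[𝓝 0] (fun h : ℝ => h ^ 4) := by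
  set v := f x with hv
  have hdc : ContinuousAt d 0 := hd.self_of_nhds.continuousAt
  have D1 : d =O[𝓝 0] (fun h : ℝ => h ^ 1) := by
    refine integrate_bigO_real d _ 0 hd0 hd ?_
    have : ContinuousAt (fun h => f (x + d h)) 0 :=
      (hfc.continuousAt).comp (continuousAt_const.add hdc)
    simpa using this.tendsto.isBigO_one ℝ
  have hRd := rem_bigO hR D1
  have hBd := (bilin_bigO B D1 D1).const_smul_left (1 / 2 : ℝ)
  have D2 : (fun h => d h - h • v) =O[𝓝 0] (fun h : ℝ => h ^ 2) := by
    refine integrate_bigO_real _ (fun h => f (x + d h) - v) 1 (by simp [hd0])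
      (hd.mono fun h hh => ?_) ?_
    · exact (hh.sub ((hasDerivAt_id h).smul_const v)).congr_deriv (by simp)
    · refine (((lin_bigO A D1).add (hBd.trans (pow_bigO_pow (by norm_num)))).add
        (hRd.trans (pow_bigO_pow (by norm_num)))).congr_left fun h => ?_
      rw [hf]; simp only [Pi.smul_apply]; abel
  have D3 : (fun h => d h - h • v - (h ^ 2 / 2) • A v) =O[𝓝 0] (fun h : ℝ => h ^ 3) := by
    refine integrate_bigO_real _ (fun h => f (x + d h) - v - h • A v) 2 (by simp [hd0])
      (hd.mono fun h hh => ?_) ?_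
    · have h2 : HasDerivAt (fun h : ℝ => h ^ 2 / 2) h h := by
        have := (hasDerivAt_pow 2 h).div_const 2
        simpa using this
      exact ((hh.sub ((hasDerivAt_id h).smul_const v)).sub (h2.smul_const (A v))).congr_deriv
        (by simp)
    · refine (((lin_bigO A D2).add hBd).add
        (hRd.trans (pow_bigO_pow (by norm_num)))).congr_left fun h => ?_
      rw [hf]; simp only [Pi.smul_apply, map_sub, map_smul]; abel
  have Dv : (fun h : ℝ => h • v) =O[𝓝 0] (fun h : ℝ => h ^ 1) := by
    simpa using smul_bigO 1 1 (const_bigO v)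
  refine integrate_bigO_real _
      (fun h => f (x + d h) - v - h • A v - (h ^ 2 / 2) • (B v v + A (A v))) 3 (by simp [hd0])
      (hd.mono fun h hh => ?_) ?_
  · have h2 : HasDerivAt (fun h : ℝ => h ^ 2 / 2) h h := by
      have := (hasDerivAt_pow 2 h).div_const 2
      simpa using this
    have h3 : HasDerivAt (fun h : ℝ => h ^ 3 / 6) (h ^ 2 / 2) h := by
      have := (hasDerivAt_pow 3 h).div_const 6
      refine this.congr_deriv ?_
      norm_num; ring
    exact (((hh.sub ((hasDerivAt_id h).smul_const v)).sub (h2.smul_const (A v))).sub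
      (h3.smul_const (B v v + A (A v)))).congr_deriv (by simp)
  · have B1 : (fun h => B (d h - h • v) (d h)) =O[𝓝 0] (fun h : ℝ => h ^ 3) :=
      bilin_bigO B D2 D1
    have B2 : (fun h => B (h • v) (d h - h • v)) =O[𝓝 0] (fun h : ℝ => h ^ 3) :=
      bilin_bigO B Dv D2
    refine (((lin_bigO A D3).add ((B1.add B2).const_smul_left (1 / 2 : ℝ))).add hRd).congr_left fun h => ?_
    rw [hf]
    simp only [Pi.smul_apply, map_sub, map_smul, _root_.sub_apply,
      _root_.smul_apply]
    module

/-- Expansion of the numerical scheme. -/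
lemma scheme_expansion (f : E → E) (x : E) (A : E →L[ℝ] E) (B : E →L[ℝ] E →L[ℝ] E) (R : E → E)
    (hR : R =O[𝓝 0] (fun y => ‖y‖ ^ 3))
    (hf : ∀ y, f (x + y) = f x + A y + (1 / 2 : ℝ) • B y y + R y)
    (w : ℝ → E) (hw : ∀ h, w h = (h / 4) • (f (x + h • f x) - f (x - h • f x))) :
    (fun h => w h + (h / 6) • (f (x + h • f x + w h) - (2 : ℝ) • f x + f (x - h • f x + w h))
      - (h ^ 2 / 2) • A (f x)
      - (h ^ 3 / 6) • (B (f x) (f x) + A (A (f x)))) =O[𝓝 0] (fun h : ℝ => h ^ 4) := by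
  set v := f x with hv
  have Dv : (fun h : ℝ => h • v) =O[𝓝 0] (fun h : ℝ => h ^ 1) := by
    simpa using smul_bigO 1 1 (const_bigO v)
  have W4 : (fun h => w h - (h ^ 2 / 2) • A v) =O[𝓝 0] (fun h : ℝ => h ^ 4) := by
    refine (smul_bigO (1 / 4) 1 ((rem_bigO hR Dv).sub (rem_bigO hR Dv.neg_left))).congr_left
      fun h => ?_
    rw [hw, sub_eq_add_neg x, hf, hf]
    simp only [map_neg, map_smul, _root_.neg_apply, _root_.smul_apply]
    module
  have W2 : w =O[𝓝 0] (fun h : ℝ => h ^ 2) := by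
    refine ((W4.trans (pow_bigO_pow (by norm_num))).add
      (smul_bigO (1 / 2) 2 (const_bigO (A v)))).congr_left fun h => ?_
    module
  have W1 := W2.trans (pow_bigO_pow (show 1 ≤ 2 by norm_num))
  have T : (fun h => (2 : ℝ) • A (w h - (h ^ 2 / 2) • A v) + B (w h) (w h)
      + (R (h • v + w h) + R (-(h • v) + w h))) =O[𝓝 0] (fun h : ℝ => h ^ 3) :=
    ((((lin_bigO A W4).const_smul_left (2 : ℝ)).trans (pow_bigO_pow (by norm_num))).add
      ((bilin_bigO B W2 W2).trans (pow_bigO_pow (by norm_num)))).add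
      ((rem_bigO hR (Dv.add W1)).add (rem_bigO hR (Dv.neg_left.add W1)))
  refine (W4.add (smul_bigO (1 / 6) 1 T)).congr_left fun h => ?_
  rw [sub_eq_add_neg x, add_assoc x, add_assoc x, hf, hf]
  simp only [map_neg, map_add, map_sub, map_smul, _root_.neg_apply,
    _root_.add_apply, _root_.smul_apply]
  module

end helpers


/-- Local truncation error of the third-order approximate Taylor method for `u' = f u`:
with `v¹ = f (u t)`, `v² h` the centered first finite difference of `f` along the
degree-1 approximate Taylor polynomial and `v³ h` the centered second finite difference
of `f` along the degree-2 approximate Taylor polynomial, the one-step scheme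
`u t + h • v¹ + (h²/2) • v² h + (h³/6) • v³ h` approximates `u (t + h)` with error
`O(h⁴)`. -/
theorem approximate_taylor3_local_error (m : ℕ) (hm : 1 ≤ m)
    (f : (Fin m → ℝ) → Fin m → ℝ) (hf : ContDiff ℝ 4 f)
    (u : ℝ → Fin m → ℝ) (t : ℝ)
    (hu : ∀ᶠ x in nhds t, HasDerivAt u (f (u x)) x)
    (v1 : Fin m → ℝ) (hv1 : v1 = f (u t))
    (v2 : ℝ → Fin m → ℝ)
    (hv2 : ∀ h : ℝ, v2 h = (2 * h)⁻¹ • (f (u t + h • v1) - f (u t - h • v1)))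
    (v3 : ℝ → Fin m → ℝ)
    (hv3 : ∀ h : ℝ, v3 h = (h ^ 2)⁻¹ •
      (f (u t + h • v1 + (h ^ 2 / 2) • v2 h) - (2 : ℝ) • f (u t) +
        f (u t - h • v1 + (h ^ 2 / 2) • v2 h))) :
    ∃ C > 0, ∃ h₀ > 0, ∀ h : ℝ, 0 < h → h < h₀ →
      ‖u (t + h) -
        (u t + h • v1 + (h ^ 2 / 2) • v2 h + (h ^ 3 / 6) • v3 h)‖ ≤ C * h ^ 4 := by
  obtain ⟨A, B, R, hR, hT⟩ := taylor_two f hf (u t)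
  have he := exact_expansion f (u t) A B R hR hT hf.continuous (fun h => u (t + h) - u t)
    (by simp) (by
      have ht : Tendsto (fun h : ℝ => t + h) (𝓝 0) (𝓝 t) := by
        have : Continuous fun h : ℝ => t + h := by fun_prop
        simpa using this.tendsto 0
      filter_upwards [ht.eventually hu] with h hh
      have := (hh.comp_const_add t h).sub_const (u t)
      simpa using this)
  have hs := scheme_expansion f (u t) A B R hR hT _ (fun h => rfl)
  obtain ⟨C, hC, hb⟩ := (he.sub hs).exists_pos
  obtain ⟨r, hr, hball⟩ := Metric.eventually_nhds_iff_ball.1 hb.bound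
  refine ⟨C, hC, r, hr, fun h h0 hlt => ?_⟩
  have key := hball h (by rw [mem_ball_zero_iff, Real.norm_of_nonneg h0.le]; exact hlt)
  rw [norm_pow, Real.norm_of_nonneg h0.le] at key
  refine le_of_eq_of_le ?_ key
  have e2 : (h ^ 2 / 2) • v2 h = (h / 4) • (f (u t + h • f (u t)) - f (u t - h • f (u t))) := by
    rw [hv2, hv1, smul_smul]
    congr 1
    field_simp
    try norm_num
  have e3 : ∀ z : Fin m → ℝ, (h ^ 3 / 6) • ((h ^ 2)⁻¹ • z) = (h / 6) • z := by
    intro z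
    rw [smul_smul]
    congr 1
    field_simp
  rw [hv3, e3, e2, hv1]
  congr 1
  module
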